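/- arXiv:1602.01443 — 2 statements merged into one kernel-verified Lean document; each statement's English description precedes it below -/
import Mathlib

section
/- Let 1 ≤ q ≤ n and μ = m·q²/n². For every δ ≥ 2e − 1, the probability that there exist S ⊆ X and T ⊆ Y with |S| = |T| = q and C(S,T) > (1+δ)·μ is at most 2^{2q·log₂(en/q) − δ·μ}. -/
open scoped Classical

/-- The generating function of the number of samples that fall in `A`. -/
lemma sum_pow_card_filter_mem {α : Type*} [Fintype α] (A : Finset α) (b : ℝ) (m : ℕ) :
    ∑ f : Fin m → α, b ^ (Finset.univ.filter (fun j : Fin m => f j ∈ A)).card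
      = ((Fintype.card α : ℝ) + A.card * (b - 1)) ^ m := by
  have h : ∑ a : α, (if a ∈ A then b else 1) = (Fintype.card α : ℝ) + A.card * (b - 1) := by
    have h1 : ∀ a : α, (if a ∈ A then b else 1) = 1 + (if a ∈ A then b - 1 else 0) := by
      intro a
      split_ifs <;> ring
    simp [h1, Finset.sum_add_distrib, Finset.sum_ite_mem, mul_sub]
  rw [← h, Fintype.sum_pow]
  refine Finset.sum_congr rfl fun f _ => ?_
  rw [Finset.prod_ite]
  simp

/-- Exponential Markov inequality for the number of samples that fall in `A`. -/
lemma card_filter_gt_mul_rpow_le {α : Type*} [Fintype α] [Nonempty α] (A : Finset α)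
    {b : ℝ} (hb : 1 ≤ b) (m : ℕ) (s : ℝ) :
    ((Finset.univ.filter (fun f : Fin m → α =>
      ((Finset.univ.filter (fun j : Fin m => f j ∈ A)).card : ℝ) > s)).card : ℝ) * b ^ s
      ≤ (Fintype.card α : ℝ) ^ m *
        Real.exp (m * A.card / Fintype.card α * (b - 1)) := by
  have hN : (0 : ℝ) < Fintype.card α := by exact_mod_cast Fintype.card_pos
  have hb1 : 0 ≤ b - 1 := by linarith
  calc _ = ∑ f ∈ Finset.univ.filter (fun f : Fin m → α =>
          ((Finset.univ.filter (fun j : Fin m => f j ∈ A)).card : ℝ) > s), b ^ s := by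
        rw [Finset.sum_const, nsmul_eq_mul]
    _ ≤ ∑ f ∈ Finset.univ.filter (fun f : Fin m → α =>
          ((Finset.univ.filter (fun j : Fin m => f j ∈ A)).card : ℝ) > s),
          b ^ (Finset.univ.filter (fun j : Fin m => f j ∈ A)).card := by
        refine Finset.sum_le_sum fun f hf => ?_
        rw [← Real.rpow_natCast]
        exact Real.rpow_le_rpow_of_exponent_le hb (Finset.mem_filter.mp hf).2.le
    _ ≤ ∑ f : Fin m → α, b ^ (Finset.univ.filter (fun j : Fin m => f j ∈ A)).card :=
        Finset.sum_le_sum_of_subset_of_nonneg (Finset.filter_subset _ _)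
          fun f _ _ => by positivity
    _ = ((Fintype.card α : ℝ) * (A.card / Fintype.card α * (b - 1) + 1)) ^ m := by
        rw [sum_pow_card_filter_mem]
        congr 1
        field_simp
        ring
    _ ≤ ((Fintype.card α : ℝ) * Real.exp (A.card / Fintype.card α * (b - 1))) ^ m := by
        gcongr
        exact Real.add_one_le_exp _
    _ = _ := by
        rw [mul_pow, ← Real.exp_nat_mul]
        congr 2
        ring

/-- Chernoff bound with large deviation for the number of samples that fall in `A`. -/
lemma card_filter_gt_le_of_large_delta {α : Type*} [Fintype α] [Nonempty α] (A : Finset α)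
    (m : ℕ) {μ δ : ℝ} (hμ : μ = m * A.card / Fintype.card α)
    (hδ : δ ≥ 2 * Real.exp 1 - 1) :
    ((Finset.univ.filter (fun f : Fin m → α =>
      ((Finset.univ.filter (fun j : Fin m => f j ∈ A)).card : ℝ) > (1 + δ) * μ)).card : ℝ)
      ≤ (Fintype.card α : ℝ) ^ m * (2 : ℝ) ^ (-(δ * μ)) := by
  have he : 1 ≤ Real.exp 1 := Real.one_le_exp zero_le_one
  have hμ0 : 0 ≤ μ := by rw [hμ]; positivity
  have h := card_filter_gt_mul_rpow_le A (b := 2 * Real.exp 1) (by linarith) m ((1 + δ) * μ)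
  rw [← hμ] at h
  refine le_of_mul_le_mul_right (h.trans ?_)
    (show 0 < (2 * Real.exp 1) ^ ((1 + δ) * μ) by positivity)
  rw [mul_assoc, Real.mul_rpow zero_le_two (Real.exp_pos 1).le, ← mul_assoc (2 ^ _),
    ← Real.rpow_add two_pos, Real.exp_one_rpow]
  gcongr
  refine le_trans ?_ (le_mul_of_one_le_left (Real.exp_pos _).le
    (Real.one_le_rpow one_le_two (by linarith)))
  rw [Real.exp_le_exp, mul_comm]
  gcongr
  linarith

lemma choose_le_exp_mul_div_pow (n : ℕ) {q : ℕ} (hq : 1 ≤ q) :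
    (n.choose q : ℝ) ≤ (Real.exp 1 * n / q) ^ q := by
  have hq0 : (0 : ℝ) < q := by exact_mod_cast hq
  calc (n.choose q : ℝ) ≤ n ^ q / q.factorial := Nat.choose_le_pow_div q n
    _ = (n / q) ^ q * (q ^ q / q.factorial) := by
        rw [div_pow]
        field_simp
    _ ≤ (n / q) ^ q * Real.exp q := by
        gcongr
        exact Real.pow_div_factorial_le_exp _ hq0.le q
    _ = _ := by
        rw [← Real.exp_one_pow, ← mul_pow]
        congr 1
        ring

/-- Union bound over all pairs of sets of size exactly `q`: for
`δ ≥ 2e − 1`, the probability (over `m` independent uniformly random edges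
`f : Fin m → Fin n × Fin n`) that some `S, T` with `|S| = |T| = q` have
`C(S,T) > (1+δ)·μ`, where `μ = m·q²/n²`, is at most `2^{2q·log₂(en/q) − δ·μ}`. -/
theorem some_pairs_chernoff_union_large_delta (n m q : ℕ) (hq1 : 1 ≤ q) (hqn : q ≤ n)
    (μ δ : ℝ) (hμ : μ = (m : ℝ) * q ^ 2 / n ^ 2)
    (hδ : δ ≥ 2 * Real.exp 1 - 1) :
    ((Finset.univ.filter (fun f : Fin m → Fin n × Fin n =>
        ∃ S T : Finset (Fin n), S.card = q ∧ T.card = q ∧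
          (((Finset.univ.filter (fun j : Fin m => f j ∈ S ×ˢ T)).card : ℝ) > (1 + δ) * μ))).card : ℝ)
      / (Fintype.card (Fin m → Fin n × Fin n) : ℝ)
      ≤ (2 : ℝ) ^ (2 * (q : ℝ) * Real.logb 2 (Real.exp 1 * n / q) - δ * μ) := by
  have hn : 1 ≤ n := hq1.trans hqn
  have : Nonempty (Fin n) := ⟨⟨0, hn⟩⟩
  have hn0 : (0 : ℝ) < n := by exact_mod_cast hn
  have hq0 : (0 : ℝ) < q := by exact_mod_cast hq1
  set P := Finset.powersetCard q (Finset.univ : Finset (Fin n)) with hP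
  have hcard : ((P ×ˢ P).card : ℝ) ≤
      (2 : ℝ) ^ (2 * (q : ℝ) * Real.logb 2 (Real.exp 1 * n / q)) := by
    have hx : 0 < Real.exp 1 * n / q := by positivity
    rw [mul_comm (2 * (q : ℝ)), Real.rpow_mul zero_le_two, Real.rpow_logb two_pos (by norm_num) hx, mul_comm 2 (q : ℝ),
      Real.rpow_mul hx.le, Real.rpow_natCast, Real.rpow_two, Finset.card_product,
      Finset.card_powersetCard, Finset.card_univ, Fintype.card_fin, Nat.cast_mul, ← sq]
    gcongr
    exact choose_le_exp_mul_div_pow n hq1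
  have hN : (0 : ℝ) < Fintype.card (Fin m → Fin n × Fin n) := by
    exact_mod_cast Fintype.card_pos
  rw [div_le_iff₀ hN, sub_eq_add_neg, Real.rpow_add two_pos]
  have hcover : (Finset.univ.filter (fun f : Fin m → Fin n × Fin n =>
        ∃ S T : Finset (Fin n), S.card = q ∧ T.card = q ∧
          (((Finset.univ.filter (fun j : Fin m => f j ∈ S ×ˢ T)).card : ℝ) > (1 + δ) * μ)))
      ⊆ (P ×ˢ P).biUnion fun p => Finset.univ.filter (fun f : Fin m → Fin n × Fin n =>
          ((Finset.univ.filter (fun j : Fin m => f j ∈ p.1 ×ˢ p.2)).card : ℝ) > (1 + δ) * μ) := by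
    intro f hf
    obtain ⟨S, T, hS, hT, h⟩ := (Finset.mem_filter.mp hf).2
    refine Finset.mem_biUnion.mpr ⟨(S, T), ?_, Finset.mem_filter.mpr ⟨Finset.mem_univ _, h⟩⟩
    simp [hP, Finset.mem_powersetCard, hS, hT]
  calc _ ≤ ∑ p ∈ P ×ˢ P, ((Finset.univ.filter (fun f : Fin m → Fin n × Fin n =>
          ((Finset.univ.filter (fun j : Fin m => f j ∈ p.1 ×ˢ p.2)).card : ℝ)
            > (1 + δ) * μ)).card : ℝ) := by
        exact_mod_cast (Finset.card_le_card hcover).trans Finset.card_biUnion_le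
    _ ≤ ∑ _p ∈ P ×ˢ P, (Fintype.card (Fin m → Fin n × Fin n) : ℝ) * (2 : ℝ) ^ (-(δ * μ)) := by
        refine Finset.sum_le_sum fun p hp => ?_
        rw [Finset.mem_product, hP, Finset.mem_powersetCard, Finset.mem_powersetCard] at hp
        have h := card_filter_gt_le_of_large_delta (p.1 ×ˢ p.2) m (μ := μ) (δ := δ)
          (by simp [hμ, Finset.card_product, hp.1.2, hp.2.2, sq]) hδ
        simpa using h
    _ = (P ×ˢ P).card * (2 : ℝ) ^ (-(δ * μ)) * Fintype.card (Fin m → Fin n × Fin n) := by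
        rw [Finset.sum_const, nsmul_eq_mul]
        ring
    _ ≤ _ := by gcongr
end

section
/- Let E be the Hamming-distance-1 some-pairs problem on strings of length b (so n = 2^b and m = b·2^b). For every q ≥ 1, every complete mapping schema of reducer size q for E has replication rate r ≥ log₂(n)/log₂(2q) = b/log₂(2q). -/
/-- The number of pairs `(x, y) ∈ S × T` at Hamming distance one. -/
def hammingOnePairs {b : ℕ} (S T : Finset (Fin b → Bool)) : ℕ :=
  ∑ x, ∑ y, if x ∈ S ∧ y ∈ T ∧ hammingDist x y = 1 then 1 else 0

/-- The strings `x` whose extension by the leading bit `c` lies in `S`. -/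
def bitSlice {b : ℕ} (c : Bool) (S : Finset (Fin (b + 1) → Bool)) : Finset (Fin b → Bool) :=
  Finset.univ.filter fun x => (Fin.cons c x : Fin (b + 1) → Bool) ∈ S

lemma mem_bitSlice {b : ℕ} {c : Bool} {S : Finset (Fin (b + 1) → Bool)} {x : Fin b → Bool} :
    x ∈ bitSlice c S ↔ (Fin.cons c x : Fin (b + 1) → Bool) ∈ S := by
  simp [bitSlice]

lemma bitSlice_univ {b : ℕ} (c : Bool) :
    bitSlice c (Finset.univ : Finset (Fin (b + 1) → Bool)) = Finset.univ := by
  simp [bitSlice]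

lemma sum_bool_cons {b : ℕ} (f : (Fin (b + 1) → Bool) → ℕ) :
    ∑ x, f x = ∑ x : Fin b → Bool, f (Fin.cons true x) +
      ∑ x : Fin b → Bool, f (Fin.cons false x) := by
  rw [← (Fin.consEquiv fun _ : Fin (b + 1) => Bool).sum_comp, Fintype.sum_prod_type]
  simp [Fin.consEquiv]

lemma card_bitSlice_add {b : ℕ} (S : Finset (Fin (b + 1) → Bool)) :
    S.card = (bitSlice true S).card + (bitSlice false S).card := by
  have h : S.card = ∑ x, if x ∈ S then 1 else 0 := by simp
  rw [h, sum_bool_cons, bitSlice, bitSlice, Finset.card_filter, Finset.card_filter]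

lemma hammingDist_cons {b : ℕ} (c d : Bool) (x y : Fin b → Bool) :
    hammingDist (Fin.cons c x : Fin (b + 1) → Bool) (Fin.cons d y) =
      (if c = d then 0 else 1) + hammingDist x y := by
  simp only [hammingDist, Finset.card_filter, Fin.sum_univ_succ, Fin.cons_zero, Fin.cons_succ]
  by_cases h : c = d <;> simp [h]

lemma hammingOnePairs_succ {b : ℕ} (S T : Finset (Fin (b + 1) → Bool)) :
    hammingOnePairs S T =
      hammingOnePairs (bitSlice true S) (bitSlice true T) +
      hammingOnePairs (bitSlice false S) (bitSlice false T) +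
      (bitSlice true S ∩ bitSlice false T).card + (bitSlice false S ∩ bitSlice true T).card := by
  have key (c d : Bool) (hcd : c ≠ d) :
      (bitSlice c S ∩ bitSlice d T).card = ∑ x : Fin b → Bool, ∑ y : Fin b → Bool,
        if (Fin.cons c x : Fin (b + 1) → Bool) ∈ S ∧ (Fin.cons d y : Fin (b + 1) → Bool) ∈ T ∧
          hammingDist (Fin.cons c x : Fin (b + 1) → Bool) (Fin.cons d y) = 1 then 1 else 0 := by
    have h : bitSlice c S ∩ bitSlice d T =
        Finset.univ.filter fun x => x ∈ bitSlice c S ∧ x ∈ bitSlice d T := by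
      ext x; simp
    rw [h, Finset.card_filter]
    refine Finset.sum_congr rfl fun x _ => ?_
    rw [Finset.sum_eq_single x]
    · simp [hammingDist_cons, hcd, mem_bitSlice]
    · intro y _ hy
      simp [hammingDist_cons, hcd, hy.symm]
    · simp
  rw [key true false (by simp), key false true (by simp)]
  simp only [hammingOnePairs, sum_bool_cons, Finset.sum_add_distrib, mem_bitSlice]
  simp only [hammingDist_cons, if_true, zero_add]
  ring

lemma hammingOnePairs_univ (b : ℕ) :
    hammingOnePairs (Finset.univ : Finset (Fin b → Bool)) Finset.univ = b * 2 ^ b := by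
  induction b with
  | zero => simp [hammingOnePairs, hammingDist]
  | succ b ih =>
    rw [hammingOnePairs_succ]
    simp only [bitSlice_univ, ih, Finset.inter_univ, Finset.card_univ, Fintype.card_fun,
      Fintype.card_bool, Fintype.card_fin]
    ring

lemma mul_log_add_mul_log_add_le_of_le {u v : ℝ} (hu : 0 ≤ u) (huv : u ≤ v) :
    u * Real.log u + v * Real.log v + 2 * u * Real.log 2 ≤ (u + v) * Real.log (u + v) := by
  rcases hu.eq_or_lt with rfl | hu
  · simp
  have hv : 0 < v := hu.trans_le huv
  have hl : 0 ≤ u / v := by positivity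
  have hl' : 0 ≤ 1 - u / v := sub_nonneg.2 ((div_le_one hv).2 huv)
  have hmem : u ∈ Set.Ici (0 : ℝ) := hu.le
  have hmem' : u + v ∈ Set.Ici (0 : ℝ) := by simp only [Set.mem_Ici]; positivity
  have h₁ := Real.convexOn_mul_log.2 hmem hmem' hl' hl (by ring)
  have h₂ := Real.convexOn_mul_log.2 hmem hmem' hl hl' (by ring)
  simp only [smul_eq_mul] at h₁ h₂
  have e₁ : (1 - u / v) * u + u / v * (u + v) = 2 * u := by field_simp; ring
  have e₂ : u / v * u + (1 - u / v) * (u + v) = v := by field_simp; ring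
  rw [e₁, Real.log_mul two_ne_zero hu.ne'] at h₁
  rw [e₂] at h₂
  linarith

lemma mul_log_add_mul_log_add_min_le {u v : ℝ} (hu : 0 ≤ u) (hv : 0 ≤ v) :
    u * Real.log u + v * Real.log v + 2 * min u v * Real.log 2 ≤ (u + v) * Real.log (u + v) := by
  rcases le_total u v with h | h
  · rw [min_eq_left h]
    exact mul_log_add_mul_log_add_le_of_le hu h
  · rw [min_eq_right h, add_comm u v, add_comm (u * _)]
    exact mul_log_add_mul_log_add_le_of_le hv h

/-- A bipartite form of the edge-isoperimetric inequality in the hypercube. -/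
lemma two_mul_hammingOnePairs_mul_log_two_le {b : ℕ} (S T : Finset (Fin b → Bool)) :
    2 * (hammingOnePairs S T : ℝ) * Real.log 2 ≤
      ((S.card : ℝ) + T.card) * Real.log ((S.card : ℝ) + T.card) := by
  induction b with
  | zero =>
    have h : hammingOnePairs S T = 0 := by simp [hammingOnePairs, hammingDist]
    rw [h]
    have := Real.log_natCast_nonneg (S.card + T.card)
    push_cast at this
    simp only [Nat.cast_zero, mul_zero, zero_mul]
    positivity
  | succ b ih =>
    have h₁ := ih (bitSlice true S) (bitSlice true T)
    have h₂ := ih (bitSlice false S) (bitSlice false T)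
    have h₃ := mul_log_add_mul_log_add_min_le
      (u := ((bitSlice true S).card : ℝ) + (bitSlice true T).card)
      (v := ((bitSlice false S).card : ℝ) + (bitSlice false T).card)
      (by positivity) (by positivity)
    have a₁ : ((bitSlice true S ∩ bitSlice false T).card : ℝ) ≤ (bitSlice true S).card :=
      mod_cast Finset.card_le_card Finset.inter_subset_left
    have a₂ : ((bitSlice true S ∩ bitSlice false T).card : ℝ) ≤ (bitSlice false T).card :=
      mod_cast Finset.card_le_card Finset.inter_subset_right
    have a₃ : ((bitSlice false S ∩ bitSlice true T).card : ℝ) ≤ (bitSlice false S).card :=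
      mod_cast Finset.card_le_card Finset.inter_subset_left
    have a₄ : ((bitSlice false S ∩ bitSlice true T).card : ℝ) ≤ (bitSlice true T).card :=
      mod_cast Finset.card_le_card Finset.inter_subset_right
    have hmin := mul_le_mul_of_nonneg_right (le_min (add_le_add a₁ a₄)
      ((add_le_add a₂ a₃).trans_eq (add_comm _ _))) (Real.log_nonneg one_le_two)
    have hsum : (S.card : ℝ) + T.card =
        (((bitSlice true S).card : ℝ) + (bitSlice true T).card) +
        (((bitSlice false S).card : ℝ) + (bitSlice false T).card) := by
      rw [card_bitSlice_add S, card_bitSlice_add T]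
      push_cast
      ring
    rw [hsum, hammingOnePairs_succ]
    push_cast
    linarith

lemma hammingOnePairs_univ_le_sum {b p : ℕ} (S T : Fin p → Finset (Fin b → Bool))
    (hcover : ∀ x y : Fin b → Bool, hammingDist x y = 1 → ∃ i, x ∈ S i ∧ y ∈ T i) :
    hammingOnePairs (Finset.univ : Finset (Fin b → Bool)) Finset.univ ≤
      ∑ i, hammingOnePairs (S i) (T i) := by
  have hswap : ∑ i, hammingOnePairs (S i) (T i) =
      ∑ x, ∑ y, ∑ i, if x ∈ S i ∧ y ∈ T i ∧ hammingDist x y = 1 then 1 else 0 := by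
    simp only [hammingOnePairs]
    rw [Finset.sum_comm]
    exact Finset.sum_congr rfl fun x _ => Finset.sum_comm
  rw [hswap]
  refine Finset.sum_le_sum fun x _ => Finset.sum_le_sum fun y _ => ?_
  split_ifs with h
  · obtain ⟨i, hx, hy⟩ := hcover x y h.2.2
    calc 1 = if x ∈ S i ∧ y ∈ T i ∧ hammingDist x y = 1 then 1 else 0 := by simp [hx, hy, h.2.2]
      _ ≤ _ := Finset.single_le_sum
        (f := fun i => if x ∈ S i ∧ y ∈ T i ∧ hammingDist x y = 1 then 1 else 0)
        (fun _ _ => Nat.zero_le _) (Finset.mem_univ i)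
  · exact Nat.zero_le _

/-- For the Hamming-distance-1 some-pairs problem on bit strings of
length `b` (so `n = 2^b` and `m = b·2^b`), every complete mapping schema of reducer
size `q` has replication rate at least `log₂(n)/log₂(2q) = b/log₂(2q)`. -/
theorem hamming_one_replication_lower_bound (b q : ℕ) (hb : 1 ≤ b) (hq : 1 ≤ q)
    (p : ℕ) (S T : Fin p → Finset (Fin b → Bool))
    (hS : ∀ i, (S i).card = q) (hT : ∀ i, (T i).card = q)
    (hcover : ∀ x y : Fin b → Bool, hammingDist x y = 1 → ∃ i, x ∈ S i ∧ y ∈ T i) :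
    (∑ i, ((S i).card + (T i).card : ℝ)) / (2 * 2 ^ b)
      ≥ (b : ℝ) / Real.logb 2 (2 * q) := by
  have hlog : 0 < Real.logb 2 (2 * q) := by
    apply Real.logb_pos one_lt_two
    have : (1 : ℝ) ≤ q := mod_cast hq
    linarith
  have hpairs (i : Fin p) : (hammingOnePairs (S i) (T i) : ℝ) ≤ q * Real.logb 2 (2 * q) := by
    have h := two_mul_hammingOnePairs_mul_log_two_le (S i) (T i)
    rw [hS, hT, ← two_mul] at h
    rw [Real.logb, ← mul_div_assoc, le_div_iff₀ (Real.log_pos one_lt_two)]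
    linarith
  have hedges : (b : ℝ) * 2 ^ b ≤ p * (q * Real.logb 2 (2 * q)) := by
    have h : ((b * 2 ^ b : ℕ) : ℝ) ≤ ((∑ i, hammingOnePairs (S i) (T i) : ℕ) : ℝ) := by
      rw [← hammingOnePairs_univ]
      exact mod_cast hammingOnePairs_univ_le_sum S T hcover
    push_cast at h
    refine (h.trans (Finset.sum_le_sum fun i _ => hpairs i)).trans_eq ?_
    simp
  simp only [hS, hT, Finset.sum_const, Finset.card_univ, Fintype.card_fin, nsmul_eq_mul]
  rw [ge_iff_le, div_le_div_iff₀ hlog (by positivity)]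
  linarith
end
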